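/- For every positive integer k, inv(△^{k−1}(TT₂)) ≥ k/2 − 1, where △^{k−1} denotes the (k−1)-fold iteration of the operation △ and TT₂ is the transitive tournament on 2 vertices. -/

import Mathlib

/-- An oriented graph: a digraph with no loops and no pair of opposite arcs. -/
structure OrientedGraph (V : Type*) where
  arc : V → V → Prop
  irrefl' : ∀ v, ¬ arc v v
  asymm' : ∀ u v, arc u v → ¬ arc v u

namespace OrientedGraph

variable {V : Type*}

/-- An oriented graph is acyclic if it has no directed cycle. -/
def IsAcyclic (D : OrientedGraph V) : Prop := ∀ v, ¬ Relation.TransGen D.arc v v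

/-- The result of inverting the sets `X 0, …, X (k-1)` one after another:
an arc is reversed iff an odd number of the sets contain both of its end-vertices. -/
def invert (D : OrientedGraph V) {k : ℕ} (X : Fin k → Set V) : OrientedGraph V where
  arc u v := (Even {i : Fin k | u ∈ X i ∧ v ∈ X i}.ncard ∧ D.arc u v) ∨
    (¬ Even {i : Fin k | u ∈ X i ∧ v ∈ X i}.ncard ∧ D.arc v u)
  irrefl' v h := by
    rcases h with ⟨_, h⟩ | ⟨_, h⟩ <;> exact D.irrefl' v h
  asymm' u v h1 h2 := by
    have hs : {i : Fin k | v ∈ X i ∧ u ∈ X i} = {i : Fin k | u ∈ X i ∧ v ∈ X i} := by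
      ext i; simp only [Set.mem_setOf_eq]; exact and_comm
    rcases h1 with ⟨hE, h1⟩ | ⟨hE, h1⟩ <;> rcases h2 with ⟨hE', h2⟩ | ⟨hE', h2⟩ <;>
      rw [hs] at hE'
    · exact D.asymm' u v h1 h2
    · exact hE' hE
    · exact hE hE'
    · exact D.asymm' v u h1 h2

/-- A family of subsets is decycling if inverting it yields an acyclic oriented graph. -/
def IsDecycling (D : OrientedGraph V) {k : ℕ} (X : Fin k → Set V) : Prop :=
  (D.invert X).IsAcyclic

/-- The inversion number: the minimum cardinality of a decycling family. -/
noncomputable def inv (D : OrientedGraph V) : ℕ :=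
  sInf {k | ∃ X : Fin k → Set V, D.IsDecycling X}

/-- A tournament: an oriented graph whose underlying graph is complete. -/
def IsTournament (D : OrientedGraph V) : Prop :=
  ∀ u v : V, u ≠ v → D.arc u v ∨ D.arc v u

/-- The subdigraph induced by a set of vertices. -/
def induce (D : OrientedGraph V) (S : Set V) : OrientedGraph S where
  arc a b := D.arc a b
  irrefl' a := D.irrefl' a
  asymm' a b := D.asymm' a b

/-- The dijoin `L ⇒ R`: disjoint union of `L` and `R` plus all arcs from `L` to `R`. -/
def dijoin {α β : Type*} (L : OrientedGraph α) (R : OrientedGraph β) :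
    OrientedGraph (α ⊕ β) where
  arc x y :=
    match x, y with
    | Sum.inl a, Sum.inl b => L.arc a b
    | Sum.inl _, Sum.inr _ => True
    | Sum.inr _, Sum.inl _ => False
    | Sum.inr a, Sum.inr b => R.arc a b
  irrefl' x := by
    cases x with
    | inl a => exact L.irrefl' a
    | inr b => exact R.irrefl' b
  asymm' x y := by
    cases x <;> cases y
    · exact L.asymm' _ _
    · exact fun _ h => h
    · exact fun h _ => h
    · exact R.asymm' _ _

/-- The oriented graph `△(D)`, obtained from `D` by adding two new vertices `u = inr false`
and `v = inr true`, all arcs from `V(D)` to `u`, the arc `u v`, and all arcs from `v`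
to `V(D)`. -/
def triangleExt (D : OrientedGraph V) : OrientedGraph (V ⊕ Bool) where
  arc x y :=
    match x, y with
    | Sum.inl a, Sum.inl b => D.arc a b
    | Sum.inl _, Sum.inr w => w = false
    | Sum.inr w, Sum.inl _ => w = true
    | Sum.inr w, Sum.inr w' => w = false ∧ w' = true
  irrefl' x := by
    cases x with
    | inl a => exact D.irrefl' a
    | inr w => exact fun h => absurd (h.1.symm.trans h.2) (by decide)
  asymm' x y := by
    cases x <;> cases y <;> intro h1 h2
    · exact D.asymm' _ _ h1 h2
    · exact absurd (h1.symm.trans h2) (by decide)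
    · exact absurd (h2.symm.trans h1) (by decide)
    · exact absurd (h1.2.symm.trans h2.1) (by decide)

end OrientedGraph

/-- `maxInv n` is the maximum of the inversion numbers of tournaments of order `n`. -/
noncomputable def maxInv (n : ℕ) : ℕ :=
  sSup {m | ∃ T : OrientedGraph (Fin n), T.IsTournament ∧ T.inv = m}

/-- The transitive tournament on two vertices. -/
def TT2 : OrientedGraph (Fin 2) where
  arc i j := i = 0 ∧ j = 1
  irrefl' := by decide
  asymm' := by decide

/-- The vertex type of the `n`-fold iterated `△`-extension of `TT₂`. -/
def IterVertex : ℕ → Type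
  | 0 => Fin 2
  | n + 1 => IterVertex n ⊕ Bool

/-- The oriented graph `△ⁿ(TT₂)`. -/
def iterGraph : (n : ℕ) → OrientedGraph (IterVertex n)
  | 0 => TT2
  | n + 1 => (iterGraph n).triangleExt

namespace InvIter

abbrev F2 := ZMod 2
abbrev Vx := ℕ × Bool

/-- The iterated tournament, as a `0/1` matrix on `ℕ × Bool`. -/
def T (a b : Vx) : F2 :=
  if a.1 < b.1 then (if b.2 then 0 else 1)
  else if b.1 < a.1 then (if a.2 then 1 else 0)
  else (if a.2 = false ∧ b.2 = true then 1 else 0)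

lemma T_anti (a b : Vx) (h : a ≠ b) : T b a = T a b + 1 := by
  obtain ⟨i, c⟩ := a
  obtain ⟨j, d⟩ := b
  rcases lt_trichotomy i j with hij | hij | hij
  · have := hij.not_gt
    cases c <;> cases d <;> simp [T, hij, this] <;> decide
  · subst hij
    cases c <;> cases d <;> simp [T] at h ⊢ <;> decide
  · have := hij.not_gt
    cases c <;> cases d <;> simp [T, hij, this] <;> decide

/-- Inverting according to `G` leaves no cyclic triangle on the first `k` levels. -/
def NoTri (k : ℕ) (G : Vx → Vx → F2) : Prop :=
  ∀ a b c : Vx, a.1 < k → b.1 < k → c.1 < k → a ≠ b → b ≠ c → c ≠ a →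
    ¬ (G a b + T a b = G b c + T b c ∧ G b c + T b c = G c a + T c a)

section
variable {W : Type} [AddCommGroup W] [Module F2 W]

/-- A state of the reduction process. -/
structure St (k : ℕ) (S : Submodule F2 W) (B : W →ₗ[F2] W →ₗ[F2] F2) (x : Vx → W) : Prop where
  symm : ∀ y z, B y z = B z y
  mem : ∀ a, x a ∈ S
  tri : NoTri k (fun a b => B (x a) (x b))

lemma St.mono {k l : ℕ} {S : Submodule F2 W} {B : W →ₗ[F2] W →ₗ[F2] F2} {x : Vx → W}
    (h : St k S B x) (hl : l ≤ k) : St l S B x :=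
  ⟨h.symm, h.mem, fun a b c ha hb hc => h.tri a b c (ha.trans_le hl) (hb.trans_le hl)
    (hc.trans_le hl)⟩

lemma f2_cases (z : F2) : z = 0 ∨ z = 1 := by revert z; decide

/-- Transfer of `NoTri` from `k+1` levels to `k` levels, with a local rule. -/
lemma NoTri.transfer {k : ℕ} {G : Vx → Vx → F2} (h : NoTri (k + 1) G)
    (hs : ∀ a b, G a b = G b a) (G' : Vx → Vx → F2)
    (F : F2 → F2 → F2 → F2 → F2)
    (hG' : ∀ a b, G' a b = G a b + F (G a (k, false)) (G a (k, true)) (G b (k, false))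
      (G b (k, true)))
    (hF : ∀ p ga ha gb hb gc hc ab bc ca : F2, p = G (k, false) (k, true) →
      ¬ (ga + 1 = p + 1 ∧ p + 1 = ha + 1) → ¬ (gb + 1 = p + 1 ∧ p + 1 = hb + 1) →
      ¬ (gc + 1 = p + 1 ∧ p + 1 = hc + 1) →
      ¬ (ab = gb + 1 ∧ gb + 1 = ga) → ¬ (bc = gc + 1 ∧ gc + 1 = gb) →
      ¬ (ca = ga + 1 ∧ ga + 1 = gc) →
      ¬ (ab = hb ∧ hb = ha + 1) → ¬ (bc = hc ∧ hc = hb + 1) →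
      ¬ (ca = ha ∧ ha = hc + 1) → ¬ (ab = bc ∧ bc = ca) →
      ¬ (ab + F ga ha gb hb = bc + F gb hb gc hc ∧
        bc + F gb hb gc hc = ca + F gc hc ga ha)) :
    NoTri k G' := by
  intro a b c ha hb hc hab hbc hca
  have ne : ∀ (a : Vx) (d : Bool), a.1 < k → a ≠ (k, d) := by
    rintro ⟨i, e⟩ d hi h
    simp only [Prod.mk.injEq] at h
    simp only at hi
    omega
  have Tu : ∀ a : Vx, a.1 < k → T a (k, false) = 1 := by
    intro a ha; simp [T, ha]
  have Tu' : ∀ a : Vx, a.1 < k → T (k, false) a = 0 := by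
    intro a ha; simp [T, ha, ha.not_gt]
  have Tv : ∀ a : Vx, a.1 < k → T a (k, true) = 0 := by
    intro a ha; simp [T, ha]
  have Tv' : ∀ a : Vx, a.1 < k → T (k, true) a = 1 := by
    intro a ha; simp [T, ha, ha.not_gt]
  have Tuv : T (k, false) (k, true) = 1 := by simp [T]
  have t1 : ∀ a : Vx, a.1 < k → ¬ (G a (k, false) + 1 = G (k, false) (k, true) + 1 ∧
      G (k, false) (k, true) + 1 = G a (k, true) + 1) := by
    intro a ha
    have := h a (k, false) (k, true) (by omega) (by simp) (by simp) (ne a _ ha) (by simp)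
      (ne a _ ha).symm
    rwa [Tu a ha, Tuv, Tv' a ha, hs (k, true) a] at this
  have t2 : ∀ a b : Vx, a.1 < k → b.1 < k → a ≠ b →
      ¬ (G a b + T a b = G b (k, false) + 1 ∧ G b (k, false) + 1 = G a (k, false)) := by
    intro a b ha hb hab
    have := h a b (k, false) (by omega) (by omega) (by simp) hab (ne b _ hb) (ne a _ ha).symm
    rwa [Tu b hb, Tu' a ha, hs (k, false) a, add_zero] at this
  have t3 : ∀ a b : Vx, a.1 < k → b.1 < k → a ≠ b →
      ¬ (G a b + T a b = G b (k, true) ∧ G b (k, true) = G a (k, true) + 1) := by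
    intro a b ha hb hab
    have := h a b (k, true) (by omega) (by omega) (by simp) hab (ne b _ hb) (ne a _ ha).symm
    rwa [Tv b hb, Tv' a ha, hs (k, true) a, add_zero] at this
  have := hF _ _ _ _ _ _ _ (G a b + T a b) (G b c + T b c) (G c a + T c a) rfl (t1 a ha)
    (t1 b hb) (t1 c hc) (t2 a b ha hb hab) (t2 b c hb hc hbc) (t2 c a hc ha hca)
    (t3 a b ha hb hab) (t3 b c hb hc hbc) (t3 c a hc ha hca)
    (h a b c (by omega) (by omega) (by omega) hab hbc hca)
  rw [hG', hG', hG']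
  simpa only [add_right_comm] using this

/-- Projection along a vector of norm one. -/
def projx (B : W →ₗ[F2] W →ₗ[F2] F2) (w : W) (x : Vx → W) (a : Vx) : W := x a + B w (x a) • w

lemma f2_add_self (z : F2) : z + z = 0 := by revert z; decide

lemma proj_finrank [FiniteDimensional F2 W] {S : Submodule F2 W} {B : W →ₗ[F2] W →ₗ[F2] F2}
    {w : W} (hw : w ∈ S) (hww : B w w = 1) :
    Module.finrank F2 (S ⊓ LinearMap.ker (B w) : Submodule F2 W) < Module.finrank F2 S := by
  apply Submodule.finrank_lt_finrank_of_lt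
  refine lt_of_le_of_ne inf_le_left fun h => ?_
  have : w ∈ S ⊓ LinearMap.ker (B w) := by rw [h]; exact hw
  have h2 := this.2
  simp only [SetLike.mem_coe, LinearMap.mem_ker] at h2
  rw [hww] at h2
  exact absurd h2 (by decide)

lemma proj_mem {S : Submodule F2 W} {B : W →ₗ[F2] W →ₗ[F2] F2} {x : Vx → W}
    (hx : ∀ a, x a ∈ S) {w : W} (hw : w ∈ S) (hww : B w w = 1) (a : Vx) :
    projx B w x a ∈ S ⊓ LinearMap.ker (B w) := by
  refine ⟨S.add_mem (hx a) (S.smul_mem _ hw), ?_⟩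
  simp [projx, hww, f2_add_self]

lemma proj_gram {B : W →ₗ[F2] W →ₗ[F2] F2} (hs : ∀ y z, B y z = B z y) (x : Vx → W)
    {w : W} (hww : B w w = 1) (a b : Vx) :
    B (projx B w x a) (projx B w x b) = B (x a) (x b) + B w (x a) * B w (x b) := by
  simp only [projx, map_add, map_smul, LinearMap.add_apply, LinearMap.smul_apply, smul_eq_mul,
    hww, hs (x a) w]
  generalize B (x a) (x b) = p
  generalize B w (x a) = q
  generalize B w (x b) = r
  revert p q r; decide

/-- The twisted form. -/
def twB (B : W →ₗ[F2] W →ₗ[F2] F2) (u : W) : W →ₗ[F2] W →ₗ[F2] F2 :=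
  B + LinearMap.mk₂ F2 (fun y z => B u y * B u z)
    (by intros; simp [add_mul]) (by intros; simp [mul_assoc])
    (by intros; simp [mul_add]) (by intros; simp [mul_left_comm])

lemma twB_apply (B : W →ₗ[F2] W →ₗ[F2] F2) (u y z : W) :
    twB B u y z = B y z + B u y * B u z := by simp [twB]

def twx (B : W →ₗ[F2] W →ₗ[F2] F2) (u : W) (x : Vx → W) (a : Vx) : W :=
  x a + (1 + B u (x a)) • u

lemma tw_gram {B : W →ₗ[F2] W →ₗ[F2] F2} (hs : ∀ y z, B y z = B z y) (x : Vx → W)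
    {u : W} (hu : B u u = 0) (a b : Vx) :
    twB B u (twx B u x a) (twx B u x b) =
      B (x a) (x b) + (B u (x a) + B u (x b) + B u (x a) * B u (x b)) := by
  simp only [twB_apply, twx, map_add, map_smul, LinearMap.add_apply, LinearMap.smul_apply,
    smul_eq_mul, hu, hs (x a) u]
  generalize B (x a) (x b) = p
  generalize B u (x a) = q
  generalize B u (x b) = r
  revert p q r; decide

lemma tw_symm {B : W →ₗ[F2] W →ₗ[F2] F2} (hs : ∀ y z, B y z = B z y) (u y z : W) :
    twB B u y z = twB B u z y := by
  rw [twB_apply, twB_apply, hs y z, mul_comm]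

set_option synthInstance.maxHeartbeats 400000 in
set_option synthInstance.maxSize 2000 in
set_option maxRecDepth 100000 in
set_option maxHeartbeats 4000000 in
/-- Reduction losing one level and one dimension. -/
lemma drop1 [FiniteDimensional F2 W] {k : ℕ} {S : Submodule F2 W}
    {B : W →ₗ[F2] W →ₗ[F2] F2} {x : Vx → W} (h : St (k + 1) S B x)
    (hg : B (x (k, false)) (x (k, false)) = 1 ∨ B (x (k, true)) (x (k, true)) = 1 ∨
      B (x (k, false)) (x (k, true)) = 1) :
    ∃ (S' : Submodule F2 W) (B' : W →ₗ[F2] W →ₗ[F2] F2) (x' : Vx → W), St k S' B' x' ∧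
      Module.finrank F2 S' < Module.finrank F2 S := by
  by_cases hu : B (x (k, false)) (x (k, false)) = 1
  · refine ⟨_, B, projx B (x (k, false)) x, ⟨h.symm, proj_mem h.mem (h.mem _) hu, ?_⟩,
      proj_finrank (h.mem _) hu⟩
    refine h.tri.transfer (fun _ _ => h.symm _ _) _ (fun ga _ gb _ => ga * gb) ?_ ?_
    · intro a b
      rw [proj_gram h.symm x hu, h.symm (x (k, false)) (x a), h.symm (x (k, false)) (x b)]
    · intro p ga ha gb hb gc hc ab bc ca hp
      clear hp
      revert p ga ha gb hb gc hc ab bc ca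
      decide
  by_cases hv : B (x (k, true)) (x (k, true)) = 1
  · refine ⟨_, B, projx B (x (k, true)) x, ⟨h.symm, proj_mem h.mem (h.mem _) hv, ?_⟩,
      proj_finrank (h.mem _) hv⟩
    refine h.tri.transfer (fun _ _ => h.symm _ _) _ (fun _ ha _ hb => ha * hb) ?_ ?_
    · intro a b
      rw [proj_gram h.symm x hv, h.symm (x (k, true)) (x a), h.symm (x (k, true)) (x b)]
    · intro p ga ha gb hb gc hc ab bc ca hp
      clear hp
      revert p ga ha gb hb gc hc ab bc ca
      decide
  have huv : B (x (k, false)) (x (k, true)) = 1 := by tauto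
  replace hu := (f2_cases _).resolve_right hu
  replace hv := (f2_cases _).resolve_right hv
  set u := x (k, false) with hu'
  set v := x (k, true) with hv'
  have hvu : B v u = 1 := by rw [h.symm, huv]
  have hww : twB B u (u + v) (u + v) = 1 := by
    simp only [twB_apply, map_add, LinearMap.add_apply, hu, hv, huv, hvu]; decide
  have hs := tw_symm h.symm u
  have hm : ∀ a, twx B u x a ∈ S := fun a => S.add_mem (h.mem _) (S.smul_mem _ (h.mem _))
  have hwm : u + v ∈ S := S.add_mem (h.mem _) (h.mem _)
  refine ⟨_, twB B u, projx (twB B u) (u + v) (twx B u x), ⟨hs, proj_mem hm hwm hww, ?_⟩,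
      proj_finrank hwm hww⟩
  refine h.tri.transfer (fun _ _ => h.symm _ _) _
    (fun ga ha gb hb => ga + gb + ga * gb + (ga + ha + 1) * (gb + hb + 1)) ?_ ?_
  · intro a b
    have key : ∀ a, twB B u (u + v) (twx B u x a) = B (x a) u + B (x a) v + 1 := by
      intro a
      simp only [twB_apply, twx, map_add, map_smul, LinearMap.add_apply, smul_eq_mul,
        hu, hv, huv, hvu, h.symm (x a)]
      generalize B u (x a) = q
      generalize B v (x a) = r
      revert q r; decide
    rw [proj_gram hs _ hww, tw_gram h.symm x hu, key, key, h.symm u (x a), h.symm u (x b),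
      add_assoc]
  · intro p ga ha gb hb gc hc ab bc ca hp
    simp only [← hu', ← hv', huv] at hp
    subst hp
    revert ga ha gb hb gc hc ab bc ca
    decide

set_option synthInstance.maxHeartbeats 400000 in
set_option synthInstance.maxSize 2000 in
set_option maxRecDepth 100000 in
set_option maxHeartbeats 4000000 in
/-- Twisting along one of the two top vertices. -/
lemma twist {k : ℕ} {S : Submodule F2 W}
    {B : W →ₗ[F2] W →ₗ[F2] F2} {x : Vx → W} (h : St (k + 1) S B x) (e : Bool)
    (hu : B (x (k, e)) (x (k, e)) = 0) :
    St k S (twB B (x (k, e))) (twx B (x (k, e)) x) := by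
  refine ⟨tw_symm h.symm _, fun a => S.add_mem (h.mem _) (S.smul_mem _ (h.mem _)), ?_⟩
  refine h.tri.transfer (fun _ _ => h.symm _ _) _ (fun ga ha gb hb => bif e then
    ha + hb + ha * hb else ga + gb + ga * gb) ?_ ?_
  · intro a b
    rw [tw_gram h.symm x hu, h.symm (x (k, e)) (x a), h.symm (x (k, e)) (x b)]
    cases e <;> rfl
  · intro p ga ha gb hb gc hc ab bc ca hp
    clear hp
    revert p ga ha gb hb gc hc ab bc ca
    cases e <;> decide

lemma tw_diag {B : W →ₗ[F2] W →ₗ[F2] F2} (hs : ∀ y z, B y z = B z y) (x : Vx → W)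
    {u : W} (hu : B u u = 0) (a : Vx) (ha : B (x a) (x a) = 0) (hau : B (x a) u = 1) :
    twB B u (twx B u x a) (twx B u x a) = 1 := by
  rw [tw_gram hs x hu, ha, hs u, hau]; decide

lemma main [FiniteDimensional F2 W] (k : ℕ) : ∀ {S : Submodule F2 W}
    {B : W →ₗ[F2] W →ₗ[F2] F2} {x : Vx → W}, St k S B x →
    k ≤ 2 * Module.finrank F2 S + 2 := by
  induction k using Nat.strong_induction_on with
  | _ k ih =>
  intro S B x h
  by_cases hk : k ≤ 2
  · omega
  obtain ⟨n, rfl⟩ : ∃ n, k = n + 1 + 1 := ⟨k - 2, by omega⟩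
  by_cases hg : B (x (n + 1, false)) (x (n + 1, false)) = 1 ∨
      B (x (n + 1, true)) (x (n + 1, true)) = 1 ∨ B (x (n + 1, false)) (x (n + 1, true)) = 1
  · obtain ⟨S', B', x', h', hlt⟩ := drop1 h hg
    have := ih (n + 1) (by omega) h'
    omega
  push Not at hg
  have hu := (f2_cases _).resolve_right hg.1
  have hv := (f2_cases _).resolve_right hg.2.1
  have huv := (f2_cases _).resolve_right hg.2.2
  have key : ∃ (B' : W →ₗ[F2] W →ₗ[F2] F2) (x' : Vx → W), St (n + 1) S B' x' ∧
      (B' (x' (n, false)) (x' (n, false)) = 1 ∨ B' (x' (n, true)) (x' (n, true)) = 1) := by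
    by_cases h0 : B (x (n, false)) (x (n, false)) = 1
    · exact ⟨B, x, h.mono (by omega), Or.inl h0⟩
    replace h0 := (f2_cases _).resolve_right h0
    have ht := h.tri (n, false) (n + 1, false) (n + 1, true) (by simp) (by simp)
      (by simp) (by simp) (by simp) (by simp)
    simp only [huv, h.symm (x (n + 1, true)) (x (n, false))] at ht
    by_cases h1 : B (x (n, false)) (x (n + 1, false)) = 1
    · exact ⟨_, _, twist h false hu, Or.inl (tw_diag h.symm x hu _ h0 h1)⟩
    by_cases h2 : B (x (n, false)) (x (n + 1, true)) = 1
    · exact ⟨_, _, twist h true hv, Or.inl (tw_diag h.symm x hv _ h0 h2)⟩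
    replace h1 := (f2_cases _).resolve_right h1
    replace h2 := (f2_cases _).resolve_right h2
    exfalso
    apply ht
    rw [h1, h2]
    simp [T]
  obtain ⟨B', x', h', hd⟩ := key
  obtain ⟨S'', B'', x'', h'', hlt⟩ := drop1 h' (by tauto)
  have := ih n (by omega) h''
  omega

end

/-! ### The link with the graphs -/

def phi : (n : ℕ) → Vx → IterVertex n
  | 0, a => (if a.2 then (1 : Fin 2) else 0 : Fin 2)
  | n + 1, a => if a.1 = n + 1 then Sum.inr a.2 else Sum.inl (phi n a)

lemma phi_arc (n : ℕ) : ∀ a b : Vx, a.1 < n + 1 → b.1 < n + 1 →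
    ((iterGraph n).arc (phi n a) (phi n b) ↔ T a b = 1) := by
  induction n with
  | zero =>
    rintro ⟨i, c⟩ ⟨j, d⟩ hi hj
    simp only at hi hj
    obtain rfl : i = 0 := by omega
    obtain rfl : j = 0 := by omega
    cases c <;> cases d <;> simp [phi, iterGraph, TT2, T]
  | succ n ih =>
    rintro ⟨i, c⟩ ⟨j, d⟩ hi hj
    simp only at hi hj
    by_cases h1 : i = n + 1 <;> by_cases h2 : j = n + 1
    · subst h1 h2
      simp only [phi, if_true]
      cases c <;> cases d <;> simp [iterGraph, OrientedGraph.triangleExt, T]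
    · have h3 : j < n + 1 := by omega
      subst h1
      simp only [phi, if_true, h2, if_false]
      cases c <;> cases d <;>
        simp [iterGraph, OrientedGraph.triangleExt, T, h3, h3.not_gt]
    · have h3 : i < n + 1 := by omega
      subst h2
      simp only [phi, if_true, h1, if_false]
      cases c <;> cases d <;>
        simp [iterGraph, OrientedGraph.triangleExt, T, h3]
    · simp only [phi, h1, h2, if_false]
      exact ih (i, c) (j, d) (by simp; omega) (by simp; omega)

open Classical in
lemma ncard_cast {m : ℕ} (P : Fin m → Prop) :
    (({i | P i}.ncard : ℕ) : F2) = ∑ i, if P i then 1 else 0 := by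
  rw [Finset.sum_boole, ← Set.ncard_coe_finset]
  simp

open Classical in
lemma even_ncard {m : ℕ} (P : Fin m → Prop) :
    Even {i | P i}.ncard ↔ (∑ i, if P i then 1 else 0 : F2) = 0 := by
  rw [← ncard_cast, ZMod.natCast_eq_zero_iff_even]

open Classical in
/-- characteristic vectors -/
noncomputable def vec {V : Type} {m : ℕ} (X : Fin m → Set V) (y : V) : Fin m → F2 :=
  fun i => if y ∈ X i then 1 else 0

noncomputable def dotB (m : ℕ) : (Fin m → F2) →ₗ[F2] (Fin m → F2) →ₗ[F2] F2 :=
  LinearMap.mk₂ F2 (fun y z => y ⬝ᵥ z) (by intros; simp [add_dotProduct])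
    (by intros; simp) (by intros; simp [dotProduct_add]) (by intros; simp)

lemma even_dot {V : Type} {m : ℕ} (X : Fin m → Set V) (y z : V) :
    Even {i | y ∈ X i ∧ z ∈ X i}.ncard ↔ dotB m (vec X y) (vec X z) = 0 := by
  classical
  rw [even_ncard]
  apply iff_of_eq
  congr 1
  simp only [dotB, LinearMap.mk₂_apply, dotProduct, vec]
  refine Finset.sum_congr rfl fun i _ => ?_
  by_cases h1 : y ∈ X i <;> by_cases h2 : z ∈ X i <;> simp [h1, h2]

lemma invert_arc {n m : ℕ} (X : Fin m → Set (IterVertex n)) (a b : Vx) (ha : a.1 < n + 1)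
    (hb : b.1 < n + 1) (hab : a ≠ b)
    (h : dotB m (vec X (phi n a)) (vec X (phi n b)) + T a b = 1) :
    ((iterGraph n).invert X).arc (phi n a) (phi n b) := by
  simp only [OrientedGraph.invert, even_dot, phi_arc n a b ha hb, phi_arc n b a hb ha,
    T_anti a b hab]
  revert h
  generalize dotB m (vec X (phi n a)) (vec X (phi n b)) = p
  generalize T a b = q
  revert p q; decide

lemma dotB_symm (m : ℕ) (y z : Fin m → F2) : dotB m y z = dotB m z y := by
  simp [dotB, dotProduct_comm]

lemma bound {n m : ℕ} (X : Fin m → Set (IterVertex n)) (h : (iterGraph n).IsDecycling X) :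
    n + 1 ≤ 2 * m + 2 := by
  have st : St (n + 1) (⊤ : Submodule F2 (Fin m → F2)) (dotB m) (fun a => vec X (phi n a)) := by
    refine ⟨dotB_symm m, fun _ => trivial, ?_⟩
    rintro a b c ha hb hc hab hbc hca ⟨e1, e2⟩
    simp only at e1 e2
    have rev : ∀ a b : Vx, a ≠ b → dotB m (vec X (phi n a)) (vec X (phi n b)) + T a b = 0 →
        dotB m (vec X (phi n b)) (vec X (phi n a)) + T b a = 1 := by
      intro a b hab h
      rw [T_anti a b hab, dotB_symm, ← add_assoc, h, zero_add]
    rcases f2_cases (dotB m (vec X (phi n a)) (vec X (phi n b)) + T a b) with h0 | h0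
    · have r1 := invert_arc X b a hb ha hab.symm (rev _ _ hab h0)
      have r2 := invert_arc X c b hc hb hbc.symm (rev _ _ hbc (e1 ▸ h0))
      have r3 := invert_arc X a c ha hc hca.symm (rev _ _ hca (e2 ▸ e1 ▸ h0))
      exact h (phi n a) (((Relation.TransGen.single r3).tail r2).tail r1)
    · have r1 := invert_arc X a b ha hb hab h0
      have r2 := invert_arc X b c hb hc hbc (e1 ▸ h0)
      have r3 := invert_arc X c a hc ha hca (e2 ▸ e1 ▸ h0)
      exact h (phi n a) (((Relation.TransGen.single r1).tail r2).tail r3)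
  have := main (n + 1) st
  simpa using this

/-! ### Existence of decycling families -/

def extX {V : Type} {m : ℕ} (X : Fin m → Set V) : Fin (m + 2) → Set (V ⊕ Bool) :=
  Fin.cons {y | y ≠ Sum.inr true} (Fin.cons (Set.range Sum.inl) fun i => Sum.inl '' X i)

lemma ext_decycling {V : Type} {m : ℕ} (D : OrientedGraph V) (X : Fin m → Set V)
    (h : D.IsDecycling X) : D.triangleExt.IsDecycling (extX X) := by
  classical
  have h11 : (1 : F2) + 1 = 0 := by decide
  have e1 : ∀ a b : V, (D.triangleExt.invert (extX X)).arc (Sum.inl a) (Sum.inl b) →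
      (D.invert X).arc a b := by
    intro a b
    simp only [OrientedGraph.invert, even_ncard, extX, Fin.sum_univ_succ]
    simp [← add_assoc, h11, OrientedGraph.triangleExt, -Finset.sum_boole]
    intro h
    convert h
  have e2 : ∀ (a : V) (w : Bool),
      ¬ (D.triangleExt.invert (extX X)).arc (Sum.inl a) (Sum.inr w) := by
    intro a w
    simp only [OrientedGraph.invert, even_ncard, extX, Fin.sum_univ_succ]
    cases w <;> simp [OrientedGraph.triangleExt]
  have e3 : ∀ (w w' : Bool), (D.triangleExt.invert (extX X)).arc (Sum.inr w) (Sum.inr w') →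
      w = false ∧ w' = true := by
    intro w w'
    simp only [OrientedGraph.invert, even_ncard, extX, Fin.sum_univ_succ]
    cases w <;> cases w' <;> simp [OrientedGraph.triangleExt]
  have key : ∀ y z, Relation.TransGen (D.triangleExt.invert (extX X)).arc y z →
      (∀ a, y = Sum.inl a → ∃ b, z = Sum.inl b ∧ Relation.TransGen (D.invert X).arc a b) ∧
      (∀ w w', y = Sum.inr w → z = Sum.inr w' → w = false ∧ w' = true) := by
    intro y z hyz
    induction hyz with
    | @single z hz =>
      refine ⟨?_, ?_⟩
      · rintro a rfl
        rcases z with b | w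
        · exact ⟨b, rfl, .single (e1 _ _ hz)⟩
        · exact absurd hz (e2 _ _)
      · rintro w w' rfl rfl
        exact e3 _ _ hz
    | @tail z t _ hz ih =>
      refine ⟨?_, ?_⟩
      · intro a ha
        obtain ⟨b, rfl, hb⟩ := ih.1 a ha
        rcases t with c | w
        · exact ⟨c, rfl, hb.tail (e1 _ _ hz)⟩
        · exact absurd hz (e2 _ _)
      · rintro w w' hw rfl
        rcases z with b | w2
        · exact absurd hz (e2 _ _)
        · exact ⟨(ih.2 w w2 hw rfl).1, (e3 _ _ hz).2⟩
  intro y hy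
  rcases y with a | w
  · obtain ⟨b, hb, hab⟩ := (key _ _ hy).1 a rfl
    cases hb
    exact h a hab
  · have := (key _ _ hy).2 w w rfl rfl
    exact absurd (this.1.symm.trans this.2) (by decide)

lemma exists_decycling (n : ℕ) :
    ∃ (m : ℕ) (X : Fin m → Set (IterVertex n)), (iterGraph n).IsDecycling X := by
  induction n with
  | zero =>
    refine ⟨0, fun _ => ∅, ?_⟩
    have key : ∀ y z : Fin 2, Relation.TransGen (TT2.invert (fun _ : Fin 0 => ∅)).arc y z →
        y = 0 ∧ z = 1 := by
      have e : ∀ y z : Fin 2, (TT2.invert (fun _ : Fin 0 => ∅)).arc y z → y = 0 ∧ z = 1 := by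
        intro y z
        simp [OrientedGraph.invert, TT2]
      intro y z h
      induction h with
      | single h => exact e _ _ h
      | tail _ h ih => exact ⟨ih.1, (e _ _ h).2⟩
    intro y hy
    have := key y y hy
    exact absurd (this.1.symm.trans this.2) (by decide)
  | succ n ih =>
    obtain ⟨m, X, h⟩ := ih
    exact ⟨m + 2, extX X, ext_decycling _ X h⟩

end InvIter

/-- for every positive integer `k`, `inv(△^{k-1}(TT₂)) ≥ k/2 - 1`. -/
theorem inv_iterGraph_ge (k : ℕ) (hk : 1 ≤ k) :
    (k : ℝ) / 2 - 1 ≤ ((iterGraph (k - 1)).inv : ℝ) := by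
  have hne : {m | ∃ X : Fin m → Set (IterVertex (k - 1)),
      (iterGraph (k - 1)).IsDecycling X}.Nonempty := InvIter.exists_decycling (k - 1)
  obtain ⟨X, hX⟩ := Nat.sInf_mem hne
  have h := InvIter.bound X hX
  have h2 : k ≤ 2 * (iterGraph (k - 1)).inv + 2 := by
    unfold OrientedGraph.inv
    omega
  have h3 : (k : ℝ) ≤ 2 * ((iterGraph (k - 1)).inv : ℝ) + 2 := by exact_mod_cast h2
  linarith
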